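/- For integers 2 ≤ j ≤ n define A(n,j) := Σ_{k=0}^{n-j} (-1)^k · (n-1)! / ((j-1)! · k! · (n-j-k)!) · h_{j-1}/h_{j+k-1}, where h_m = Σ_{i=1}^m 1/i. Then for every fixed integer j ≥ 2 there is a constant C_j such that for all n ≥ j, |A(n,j) - (6/π²)·h_{j-1}/(j-1)| ≤ C_j · n^{-1-|s₁|}, where s₁ ∈ (-1,0) is the unique root of ψ(s) = ψ(1) in (-1,0). In particular A(n,j) → (6/π²)·h_{j-1}/(j-1) as n → ∞. -/

import Mathlib

open Filter

/-- The digamma function on the reals: `ψ(x) = Γ'(x)/Γ(x)`. -/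
noncomputable def digamma (x : ℝ) : ℝ := deriv Real.Gamma x / Real.Gamma x

/-- The `m`-th harmonic number `h_m = ∑_{i=1}^m 1/i`, with `h_0 = 0`. -/
noncomputable def harm (m : ℕ) : ℝ := ∑ i ∈ Finset.range m, (1 : ℝ) / (i + 1)

/-- `A(n,j) = Σ_{k=0}^{n-j} (-1)^k (n-1)!/((j-1)!·k!·(n-j-k)!) · h_{j-1}/h_{j+k-1}`,
the occupation probability `a(n,j)` of the harmonic descent chain. -/
noncomputable def A (n j : ℕ) : ℝ :=
  ∑ k ∈ Finset.range (n - j + 1),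
    (-1 : ℝ) ^ k * ((n - 1).factorial : ℝ) /
      (((j - 1).factorial : ℝ) * (k.factorial : ℝ) * ((n - j - k).factorial : ℝ)) *
      (harm (j - 1) / harm (j + k - 1))

open Polynomial Finset in
theorem aux_root (L i : ℕ) (hi : i < L) :
    ∃ y : ℝ, -((i:ℝ)+2) < y ∧ y < -((i:ℝ)+1) ∧
      (∑ k ∈ range (L+1), 1/((k:ℝ)+1) * ∏ l ∈ (range (L+1)).erase k, (y + ((l:ℝ)+1))) = 0 := by
  set F : ℝ → ℝ := fun y =>
    ∑ k ∈ range (L+1), 1/((k:ℝ)+1) * ∏ l ∈ (range (L+1)).erase k, (y + ((l:ℝ)+1)) with hF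
  have hc : Continuous F := by
    rw [hF]; fun_prop
  have hval : ∀ m ∈ range (L+1), F (-((m:ℝ)+1)) =
      1/((m:ℝ)+1) * ∏ l ∈ (range (L+1)).erase m, ((l:ℝ) - m) := by
    intro m hm
    simp only [hF]
    rw [Finset.sum_eq_single_of_mem m hm]
    · congr 1
      apply Finset.prod_congr rfl
      intro l _; ring
    · intro b _ hbm
      rw [Finset.prod_eq_zero (i := m)]
      · ring
      · exact Finset.mem_erase.2 ⟨hbm.symm, hm⟩
      · ring
  have h1m : i ∈ range (L+1) := by simp; omega
  have h2m : i+1 ∈ range (L+1) := by simp; omega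
  have h1 := hval i h1m
  have h2 := hval (i+1) h2m
  have hneg : F (-((i:ℝ)+1)) * F (-((i:ℝ)+2)) < 0 := by
    have e : (-((i:ℝ)+2)) = (-(((i+1:ℕ):ℝ)+1)) := by push_cast; ring
    rw [e, h1, h2]
    rw [← Finset.mul_prod_erase ((range (L+1)).erase i) _ (a := i+1) (by simp; omega),
      ← Finset.mul_prod_erase ((range (L+1)).erase (i+1)) _ (a := i) (by simp; omega),
      Finset.erase_right_comm (a := i+1) (b := i)]
    have hp : 0 < (∏ l ∈ ((range (L+1)).erase i).erase (i+1), ((l:ℝ) - i)) *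
        (∏ l ∈ ((range (L+1)).erase i).erase (i+1), ((l:ℝ) - (i+1:ℕ))) := by
      rw [← Finset.prod_mul_distrib]
      apply Finset.prod_pos
      intro l hl
      simp only [Finset.mem_erase] at hl
      rcases lt_or_gt_of_ne hl.2.1 with h | h
      · have : (l:ℝ) + 1 ≤ i := by exact_mod_cast h
        push_cast; nlinarith
      · have : (i:ℝ) + 2 ≤ l := by exact_mod_cast (by omega : i + 2 ≤ l)
        push_cast; nlinarith
    have ha : 0 < 1/((i:ℝ)+1) * (1/(((i+1:ℕ):ℝ)+1)) := by positivity
    have := mul_pos ha hp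
    push_cast at this ⊢
    nlinarith
  have hle : -((i:ℝ)+2) ≤ -((i:ℝ)+1) := by linarith
  rcases lt_or_ge (F (-((i:ℝ)+1))) 0 with h | h
  · have h' : 0 < F (-((i:ℝ)+2)) := by
      by_contra hh; push Not at hh
      nlinarith
    obtain ⟨y, hy, hy0⟩ := intermediate_value_Ioo' hle hc.continuousOn ⟨h, h'⟩
    exact ⟨y, hy.1, hy.2, hy0⟩
  · have h' : F (-((i:ℝ)+2)) < 0 := by
      by_contra hh; push Not at hh
      nlinarith
    have h'' : 0 < F (-((i:ℝ)+1)) := by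
      by_contra hh; push Not at hh
      nlinarith
    obtain ⟨y, hy, hy0⟩ := intermediate_value_Ioo hle hc.continuousOn ⟨h', h''⟩
    exact ⟨y, hy.1, hy.2, hy0⟩

open Finset in
theorem aux_first (L : ℕ) (ρ y : ℝ) (h1 : 1 < ρ) (h2 : ρ < 2)
    (hneg : ∑ k ∈ range (L+1), 1/(((k:ℝ)+1) * ((k:ℝ)+1-ρ)) ≤ 0)
    (hy1 : -2 < y) (hy2 : y < -1)
    (hy : (∑ k ∈ range (L+1), 1/((k:ℝ)+1) * ∏ l ∈ (range (L+1)).erase k, (y + ((l:ℝ)+1))) = 0) :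
    y ≤ -ρ := by
  by_contra hlt
  push Not at hlt
  have hne : ∀ l : ℕ, y + ((l:ℝ)+1) ≠ 0 := by
    intro l
    rcases Nat.eq_zero_or_pos l with h | h
    · subst h; push_cast; intro h; linarith
    · have : (1:ℝ) ≤ l := by exact_mod_cast h
      intro h; linarith
  have hS : (∏ l ∈ range (L+1), (y + ((l:ℝ)+1))) *
      ∑ k ∈ range (L+1), 1/(((k:ℝ)+1) * (y + ((k:ℝ)+1))) = 0 := by
    rw [← hy, Finset.mul_sum]
    apply Finset.sum_congr rfl
    intro k hk
    rw [← Finset.mul_prod_erase _ _ hk]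
    have := hne k
    have : (k:ℝ)+1 ≠ 0 := by positivity
    field_simp
  have hS0 : ∑ k ∈ range (L+1), 1/(((k:ℝ)+1) * (y + ((k:ℝ)+1))) = 0 := by
    rcases mul_eq_zero.1 hS with h | h
    · exact absurd h (Finset.prod_ne_zero_iff.2 fun l _ => hne l)
    · exact h
  have : ∑ k ∈ range (L+1), 1/(((k:ℝ)+1) * (y + ((k:ℝ)+1))) <
      ∑ k ∈ range (L+1), 1/(((k:ℝ)+1) * ((k:ℝ)+1-ρ)) := by
    apply Finset.sum_lt_sum_of_nonempty (by simp)
    intro k _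
    have hk : (0:ℝ) < (k:ℝ)+1 := by positivity
    rw [← one_div_mul_one_div, ← one_div_mul_one_div]
    apply mul_lt_mul_of_pos_left _ (by positivity)
    rcases Nat.eq_zero_or_pos k with h | h
    · subst h
      apply one_div_lt_one_div_of_neg_of_lt <;> push_cast <;> linarith
    · have : (1:ℝ) ≤ k := by exact_mod_cast h
      apply one_div_lt_one_div_of_lt <;> linarith
  linarith

open Polynomial Finset in
theorem aux_pf (L : ℕ) (ρ : ℝ) (h1 : 1 < ρ) (h2 : ρ < 2)
    (hneg : ∑ k ∈ range (L+1), 1/(((k:ℝ)+1) * ((k:ℝ)+1-ρ)) ≤ 0) :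
    ∃ c r : ℕ → ℝ, (∀ i < L, 0 < c i ∧ ρ ≤ r i) ∧ ∀ x : ℝ, 0 < x →
      1 / (∑ k ∈ range (L+1), x / (((k:ℝ)+1) * (x + ((k:ℝ)+1)))) =
        1 / harm (L+1) + (1 / ∑ k ∈ range (L+1), 1/((k:ℝ)+1)^2) / x
          + ∑ i ∈ range L, c i / (x + r i) := by
  choose! y hy1 hy2 hy using aux_root L
  let v : ℕ → ℝ := fun i => if i = 0 then 0 else y (i-1)
  let u : ℕ → ℝ := fun l => -((l:ℝ)+1)
  let s := range (L+1)
  have hv0 : v 0 = 0 := rfl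
  have hvs : ∀ i, v (i+1) = y i := fun i => by simp [v]
  have hvlo : ∀ i ∈ s, -((i:ℝ)+1) < v i := by
    intro i hi
    rcases i with _ | i
    · rw [hv0]; norm_num
    · rw [hvs]; have := hy1 i (by simp [s] at hi; omega); push_cast; linarith
  have hvle : ∀ i ∈ s, v i ≤ -(i:ℝ) := by
    intro i hi
    rcases i with _ | i
    · rw [hv0]; norm_num
    · rw [hvs]; have := hy2 i (by simp [s] at hi; omega); push_cast; linarith
  have hvhi : ∀ i ∈ s, i ≠ 0 → v i < -(i:ℝ) := by
    intro i hi h0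
    rcases i with _ | i
    · exact absurd rfl h0
    · rw [hvs]; have := hy2 i (by simp [s] at hi; omega); push_cast; linarith
  have hlt : ∀ i ∈ s, ∀ l ∈ s, i < l → v l < v i := by
    intro i hi l hl hil
    have a := hvlo i hi
    have b := hvle l hl
    have : (i:ℝ)+1 ≤ l := by exact_mod_cast hil
    linarith
  have hinj : Set.InjOn v s := by
    intro i hi l hl h
    by_contra hne
    rcases lt_or_gt_of_ne hne with h' | h'
    · have := hlt i hi l hl h'; linarith
    · have := hlt l hl i hi h'; linarith
  let P : ℝ[X] := Lagrange.nodal s u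
  let W : ℝ[X] := Lagrange.nodal s v
  let Q : ℝ[X] := ∑ k ∈ s, C (1/((k:ℝ)+1)) * Lagrange.nodal (s.erase k) u
  have hQev : ∀ x, Q.eval x =
      ∑ k ∈ s, 1/((k:ℝ)+1) * ∏ l ∈ s.erase k, (x + ((l:ℝ)+1)) := by
    intro x
    simp only [Q, eval_finsetSum, Lagrange.eval_nodal, u, eval_mul, eval_C, sub_neg_eq_add]
  have hPev : ∀ x, P.eval x = ∏ l ∈ s, (x + ((l:ℝ)+1)) := by
    intro x
    simp only [P, Lagrange.eval_nodal, u, sub_neg_eq_add]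
  have hWdeg : W.degree = #s := Lagrange.degree_nodal
  have hXQ : X * Q = C (harm (L+1)) * W := by
    apply eq_of_degree_sub_lt_of_eval_index_eq s hinj
    · have : X * Q - C (harm (L+1)) * W =
          ∑ k ∈ s, C (1/((k:ℝ)+1)) * (X * Lagrange.nodal (s.erase k) u - W) := by
        simp only [harm, Q, mul_sub, Finset.sum_sub_distrib, Finset.mul_sum, map_sum,
          Finset.sum_mul]
        congr 1
        apply Finset.sum_congr rfl; intro k _; ring
      rw [this, ← mem_degreeLT]
      apply Submodule.sum_mem
      intro k hk
      rw [← smul_eq_C_mul]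
      apply Submodule.smul_mem
      rw [mem_degreeLT]
      have hm : (X * Lagrange.nodal (s.erase k) u : ℝ[X]).Monic :=
        monic_X.mul Lagrange.nodal_monic
      have hd : (X * Lagrange.nodal (s.erase k) u : ℝ[X]).degree = #s := by
        rw [degree_mul, degree_X, Lagrange.degree_nodal, Finset.card_erase_of_mem hk]
        have : 0 < #s := Finset.card_pos.2 ⟨k, hk⟩
        rw [add_comm]; exact_mod_cast (by omega : #s - 1 + 1 = #s)
      rw [← hd]
      apply degree_sub_lt_left (by rw [hd, hWdeg]) hm.ne_zero
      rw [hm.leadingCoeff, (Lagrange.nodal_monic (s := s) (v := v)).leadingCoeff]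
    · intro i hi
      have : eval (v i) W = 0 := Lagrange.eval_nodal_at_node hi
      rw [eval_mul, eval_mul, this, eval_X]
      rcases i with _ | i
      · rw [hv0]; ring
      · rw [hvs, hQev, hy i (by simp [s] at hi; omega)]; ring
  have hHpos : 0 < harm (L+1) := by
    unfold harm
    apply Finset.sum_pos _ (by simp)
    intro i _; positivity
  have h0s : 0 ∈ s := by simp [s]
  have hQ0 : Q = C (harm (L+1)) * Lagrange.nodal (s.erase 0) v := by
    have : X * Q = X * (C (harm (L+1)) * Lagrange.nodal (s.erase 0) v) := by
      rw [hXQ]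
      simp only [W]
      rw [Lagrange.nodal_eq_mul_nodal_erase h0s, hv0]
      simp; ring
    exact mul_left_cancel₀ X_ne_zero this
  have hPW : (P - W).degree < #s := by
    have hd : P.degree = #s := Lagrange.degree_nodal
    rw [← hd]
    apply degree_sub_lt_left (by rw [hd, hWdeg]) Lagrange.nodal_ne_zero
    rw [(Lagrange.nodal_monic (s := s) (v := v)).leadingCoeff,
      (Lagrange.nodal_monic (s := s) (v := u)).leadingCoeff]
  let w : ℕ → ℝ := fun i => Lagrange.nodalWeight s v i * P.eval (v i)
  have hwpos : ∀ i ∈ s, 0 < w i := by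
    intro i hi
    simp only [w, Lagrange.nodalWeight, hPev]
    rw [← Finset.mul_prod_erase _ _ hi, mul_left_comm, ← Finset.prod_mul_distrib]
    apply mul_pos
    · have := hvlo i hi; linarith
    · apply Finset.prod_pos
      intro l hl
      have hli := (Finset.mem_erase.1 hl).1
      have hls := (Finset.mem_erase.1 hl).2
      rcases lt_or_gt_of_ne hli with h | h
      · have a := hlt l hls i hi h
        have b := hvhi i hi (by omega)
        have : (l:ℝ)+1 ≤ i := by exact_mod_cast h
        apply mul_pos_of_neg_of_neg
        · exact inv_lt_zero.2 (by linarith)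
        · linarith
      · have a := hlt i hi l hls h
        have b := hvlo i hi
        have : (i:ℝ)+1 ≤ l := by exact_mod_cast h
        apply mul_pos
        · exact inv_pos.2 (by linarith)
        · linarith
  have hw0 : w 0 / harm (L+1) = 1 / ∑ k ∈ range (L+1), 1/((k:ℝ)+1)^2 := by
    have e1 : Q.eval 0 = P.eval 0 * ∑ k ∈ range (L+1), 1/((k:ℝ)+1)^2 := by
      rw [hQev, hPev, Finset.mul_sum]
      apply Finset.sum_congr rfl
      intro k hk
      rw [← Finset.mul_prod_erase _ _ hk]
      have : (k:ℝ)+1 ≠ 0 := by positivity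
      field_simp
      ring
    have hP0 : 0 < P.eval 0 := by
      rw [hPev]; apply Finset.prod_pos; intro l _; positivity
    have hS0 : 0 < ∑ k ∈ range (L+1), 1/((k:ℝ)+1)^2 := by
      apply Finset.sum_pos _ (by simp)
      intro i _; positivity
    have e2 : Q.eval 0 = harm (L+1) * (Lagrange.nodal (s.erase 0) v).eval 0 := by
      rw [hQ0]; simp
    have e3 : w 0 = ((Lagrange.nodal (s.erase 0) v).eval 0)⁻¹ * P.eval 0 := by
      simp only [w, Lagrange.nodalWeight_eq_eval_nodal_erase_inv, hv0]
    have e4 : (Lagrange.nodal (s.erase 0) v).eval 0 ≠ 0 := by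
      intro h
      rw [h, mul_zero] at e2
      rw [e2] at e1
      have := mul_pos hP0 hS0
      linarith
    rw [e3, inv_mul_eq_div, div_div, div_eq_div_iff (mul_ne_zero e4 hHpos.ne') hS0.ne',
      ← e1, e2]
    ring
  refine ⟨fun i => w (i+1) / harm (L+1), fun i => - y i, ?_, ?_⟩
  · intro i hi
    refine ⟨div_pos (hwpos (i+1) (by simp [s]; omega)) hHpos, ?_⟩
    rcases i with _ | i
    · have a := hy1 0 hi
      have b := hy2 0 hi
      have := aux_first L ρ (y 0) h1 h2 hneg (by simpa using a) (by simpa using b) (hy 0 hi)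
      linarith
    · have b := hy2 (i+1) hi
      push_cast at b
      have : (0:ℝ) ≤ i := by positivity
      linarith
  · intro x hx
    have hxv : ∀ i ∈ s, x ≠ v i := by
      intro i hi h
      have := hvle i hi
      have : (0:ℝ) ≤ i := by positivity
      linarith
    have hWx : W.eval x ≠ 0 := Lagrange.eval_nodal_not_at_node hxv
    have key := congrArg (eval x) (Lagrange.eq_interpolate hinj hPW)
    rw [Lagrange.eval_interpolate_not_at_node _ hxv, eval_sub] at key
    have hs : ∑ i ∈ s, Lagrange.nodalWeight s v i * (x - v i)⁻¹ * eval (v i) (P - W) =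
        w 0 / x + ∑ i ∈ range L, w (i+1) / (x + - y i) := by
      have : ∀ i ∈ s, Lagrange.nodalWeight s v i * (x - v i)⁻¹ * eval (v i) (P - W) =
          w i / (x - v i) := by
        intro i hi
        have : eval (v i) W = 0 := Lagrange.eval_nodal_at_node hi
        simp only [w, eval_sub, this]
        ring
      rw [Finset.sum_congr rfl this]
      simp only [s]
      rw [Finset.sum_range_succ', hv0, add_comm]
      simp [hvs, sub_eq_add_neg]
    rw [hs] at key
    have hPx : 0 < P.eval x := by
      rw [hPev]; apply Finset.prod_pos; intro l _; positivity
    have hg : ∑ k ∈ range (L+1), x / (((k:ℝ)+1) * (x + ((k:ℝ)+1))) =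
        harm (L+1) * W.eval x / P.eval x := by
      have e := congrArg (eval x) hXQ
      rw [eval_mul, eval_mul, eval_X, eval_C] at e
      rw [← e, eq_div_iff hPx.ne', hQev, hPev, Finset.sum_mul, Finset.mul_sum]
      apply Finset.sum_congr rfl
      intro k hk
      rw [← Finset.mul_prod_erase _ _ hk]
      have : (k:ℝ)+1 ≠ 0 := by positivity
      have : x + ((k:ℝ)+1) ≠ 0 := by positivity
      field_simp
      rfl
    rw [hg, one_div_div, ← hw0]
    have hP : P.eval x = W.eval x * (1 + (w 0 / x + ∑ i ∈ range L, w (i+1) / (x + - y i))) := by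
      linarith
    rw [hP]
    have hsum : ∑ i ∈ range L, w (i+1) / harm (L+1) / (x + - y i) =
        (∑ i ∈ range L, w (i+1) / (x + - y i)) / harm (L+1) := by
      rw [Finset.sum_div]
      apply Finset.sum_congr rfl; intro i _; ring
    rw [hsum]
    have := hHpos.ne'
    field_simp
    ring

theorem digamma_rec (x : ℝ) (hx : ∀ m : ℕ, x ≠ -m) : digamma (x+1) = digamma x + 1/x := by
  have hx0 : x ≠ 0 := by simpa using hx 0
  have hd := (Real.differentiableAt_Gamma hx).hasDerivAt
  have h1 : HasDerivAt (fun y => y * Real.Gamma y) (1 * Real.Gamma x + x * deriv Real.Gamma x) x :=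
    (hasDerivAt_id x).mul hd
  have hx1 : ∀ m : ℕ, x + 1 ≠ -m := by
    intro m h
    apply hx (m+1)
    push_cast; linarith
  have h2 : HasDerivAt (fun y => Real.Gamma (y+1)) (deriv Real.Gamma (x+1)) x :=
    (Real.differentiableAt_Gamma hx1).hasDerivAt.comp_add_const x 1
  have he : (fun y => Real.Gamma (y+1)) =ᶠ[nhds x] (fun y => y * Real.Gamma y) := by
    filter_upwards [isOpen_ne.mem_nhds hx0] with y hy
    exact Real.Gamma_add_one hy
  have h3 := (h1.congr_of_eventuallyEq he).unique h2
  have hG := Real.Gamma_ne_zero hx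
  unfold digamma
  rw [← h3, Real.Gamma_add_one hx0]
  field_simp
  ring

theorem digamma_rec_sum (x : ℝ) (hx : ∀ m : ℕ, x ≠ -m) (K : ℕ) :
    digamma (x+K) = digamma x + ∑ k ∈ Finset.range K, 1/((k:ℝ)+x) := by
  induction K with
  | zero => simp
  | succ K ih =>
    rw [Finset.sum_range_succ, ← add_assoc, ← ih]
    have := digamma_rec (x+K) (by
      intro m h
      apply hx (m+K)
      push_cast; linarith)
    push_cast
    rw [← add_assoc, this, add_comm x (K:ℝ)]

theorem digamma_mono {x y : ℝ} (hx : 0 < x) (hxy : x ≤ y) : digamma x ≤ digamma y := by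
  have hdG : ∀ x ∈ Set.Ioi (0:ℝ), DifferentiableAt ℝ Real.Gamma x := by
    intro x hx
    apply Real.differentiableAt_Gamma
    intro m h
    have : (0:ℝ) ≤ m := by positivity
    have : (0:ℝ) < x := hx
    linarith
  have hne : ∀ x ∈ Set.Ioi (0:ℝ), Real.Gamma x ≠ 0 := fun x hx => (Real.Gamma_pos_of_pos hx).ne'
  have hd : ∀ x ∈ Set.Ioi (0:ℝ), deriv (Real.log ∘ Real.Gamma) x = digamma x := by
    intro x hx
    exact ((hdG x hx).hasDerivAt.log (hne x hx)).deriv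
  have := Real.convexOn_log_Gamma.monotoneOn_deriv
    (fun x hx => ((hdG x hx).log (hne x hx))) (Set.mem_Ioi.2 hx) (Set.mem_Ioi.2 (hx.trans_le hxy)) hxy
  rwa [hd x hx, hd y (hx.trans_le hxy)] at this

theorem aux_neg (s₁ : ℝ) (hs₁ : s₁ ∈ Set.Ioo (-1:ℝ) 0) (hroot : digamma s₁ = digamma 1) (L : ℕ) :
    ∑ k ∈ Finset.range (L+1), 1/(((k:ℝ)+1) * ((k:ℝ)+1-(1-s₁))) ≤ 0 := by
  obtain ⟨ha, hb⟩ := hs₁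
  have hsm : ∀ m : ℕ, s₁ ≠ -m := by
    intro m h
    rcases Nat.eq_zero_or_pos m with h' | h'
    · subst h'; simp at h; linarith
    · have : (1:ℝ) ≤ m := by exact_mod_cast h'
      linarith
  have h1m : ∀ m : ℕ, (1:ℝ) ≠ -m := by
    intro m h
    have : (0:ℝ) ≤ m := by positivity
    linarith
  have e1 := digamma_rec_sum s₁ hsm (L+1)
  have e2 := digamma_rec_sum 1 h1m (L+1)
  have hm : digamma (s₁ + (L+1:ℕ)) ≤ digamma (1 + (L+1:ℕ)) := by
    apply digamma_mono
    · push_cast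
      have : (0:ℝ) ≤ L := by positivity
      linarith
    · linarith
  have : ∑ k ∈ Finset.range (L+1), 1/(((k:ℝ)+1) * ((k:ℝ)+1-(1-s₁))) =
      (∑ k ∈ Finset.range (L+1), 1/((k:ℝ)+s₁) - ∑ k ∈ Finset.range (L+1), 1/((k:ℝ)+1)) / (1-s₁) := by
    rw [← Finset.sum_sub_distrib, Finset.sum_div]
    apply Finset.sum_congr rfl
    intro k _
    have h1 : (k:ℝ)+1 ≠ 0 := by positivity
    have h2 : (k:ℝ)+s₁ ≠ 0 := by
      intro h; apply hsm k; linarith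
    have h3 : 1 - s₁ ≠ 0 := by linarith
    have h4 : (k:ℝ)+1-(1-s₁) = k + s₁ := by ring
    rw [h4]
    field_simp
    ring
  rw [this]
  apply div_nonpos_of_nonpos_of_nonneg <;> linarith

theorem aux_prod (J M : ℕ) (ρ : ℝ) (h1 : 0 < ρ) (h2 : ρ < 2) :
    ∏ i ∈ Finset.range M, ((J:ℝ)+1+i)/((J:ℝ)+1+i+ρ) ≤ (((J:ℝ)+3)/((J:ℝ)+M+3))^ρ := by
  induction M with
  | zero =>
    have : (J:ℝ)+3 ≠ 0 := by positivity
    simp [this]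
  | succ M ih =>
    rw [Finset.prod_range_succ]
    set m : ℝ := (J:ℝ)+1+M with hm
    have hm0 : 0 < m := by positivity
    have key : m/(m+ρ) ≤ ((m+2)/(m+3))^ρ := by
      have a : m/(m+ρ) ≤ Real.exp (-(ρ/(m+ρ))) := by
        have := Real.add_one_le_exp (-(ρ/(m+ρ)))
        have e : -(ρ/(m+ρ)) + 1 = m/(m+ρ) := by field_simp; ring
        linarith
      have b : (m+3)/(m+2) ≤ Real.exp (1/(m+2)) := by
        have := Real.add_one_le_exp (1/(m+2))
        have e : 1/(m+2) + 1 = (m+3)/(m+2) := by field_simp; ring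
        linarith
      have b' : Real.exp (-(1/(m+2))) ≤ (m+2)/(m+3) := by
        rw [Real.exp_neg, ← inv_div (m+3) (m+2)]
        exact inv_anti₀ (by positivity) b
      calc m/(m+ρ) ≤ Real.exp (-(ρ/(m+ρ))) := a
        _ ≤ Real.exp (-(1/(m+2)) * ρ) := by
          apply Real.exp_le_exp.2
          have : ρ/(m+2) ≤ ρ/(m+ρ) := by gcongr
          have e : -(1/(m+2)) * ρ = -(ρ/(m+2)) := by ring
          linarith
        _ = (Real.exp (-(1/(m+2))))^ρ := by rw [Real.exp_mul]
        _ ≤ _ := by gcongr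
    calc _ ≤ (((J:ℝ)+3)/((J:ℝ)+M+3))^ρ * ((m+2)/(m+3))^ρ := by
          apply mul_le_mul ih key (by positivity) (by positivity)
      _ = _ := by
          rw [← Real.mul_rpow (by positivity) (by positivity)]
          congr 1
          have e1 : (J:ℝ)+M+3 = m+2 := by rw [hm]; ring
          have e2 : (J:ℝ)+((M+1:ℕ):ℝ)+3 = m+3 := by rw [hm]; push_cast; ring
          rw [e1, e2]
          field_simp

theorem aux_fd (M : ℕ) : ∀ x : ℝ, 0 < x →
    ∑ k ∈ Finset.range (M+1), (-1:ℝ)^k * (M.choose k) * (1/(x+k)) =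
      M.factorial / ∏ i ∈ Finset.range (M+1), (x+i) := by
  induction M with
  | zero => intro x hx; simp
  | succ M ih =>
    intro x hx
    have h1 := ih x hx
    have h2 := ih (x+1) (by linarith)
    have hrec : ∑ k ∈ Finset.range (M+1+1), (-1:ℝ)^k * ((M+1).choose k) * (1/(x+k)) =
        ∑ k ∈ Finset.range (M+1), (-1:ℝ)^k * (M.choose k) * (1/(x+k)) -
        ∑ k ∈ Finset.range (M+1), (-1:ℝ)^k * (M.choose k) * (1/(x+1+k)) := by
      rw [Finset.sum_range_succ']
      have e : ∀ k ∈ Finset.range (M+1), (-1:ℝ)^(k+1) * ((M+1).choose (k+1)) * (1/(x+(k+1:ℕ))) =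
          (-1:ℝ)^(k+1) * (M.choose (k+1)) * (1/(x+(k+1:ℕ)))
          - (-1:ℝ)^k * (M.choose k) * (1/(x+1+k)) := by
        intro k _
        rw [Nat.choose_succ_succ]
        have : x + 1 + (k:ℝ) = x + ((k+1:ℕ):ℝ) := by push_cast; ring
        rw [this]
        push_cast
        ring
      rw [Finset.sum_congr rfl e, Finset.sum_sub_distrib]
      have e3 : ∑ k ∈ Finset.range (M+1), (-1:ℝ)^k * (M.choose k) * (1/(x+k)) =
          ∑ k ∈ Finset.range (M+1), (-1:ℝ)^(k+1) * (M.choose (k+1)) * (1/(x+(k+1:ℕ)))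
          + (-1:ℝ)^0 * (M.choose 0) * (1/(x+(0:ℕ))) := by
        rw [← Finset.sum_range_succ' (fun k => (-1:ℝ)^k * (M.choose k) * (1/(x+(k:ℕ)))),
          Finset.sum_range_succ _ (M+1)]
        simp
      rw [e3]
      simp only [Nat.choose_zero_right]
      ring
    rw [hrec, h1, h2]
    have p1 : ∏ i ∈ Finset.range (M+1), (x+i) = x * ∏ i ∈ Finset.range M, (x+1+i) := by
      rw [Finset.prod_range_succ', mul_comm]
      simp only [Nat.cast_zero, add_zero]
      congr 1
      apply Finset.prod_congr rfl; intro i _; push_cast; ring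
    have p2 : ∏ i ∈ Finset.range (M+1), (x+1+i) = (∏ i ∈ Finset.range M, (x+1+i)) * (x+1+M) :=
      Finset.prod_range_succ _ _
    have p3 : ∏ i ∈ Finset.range (M+1+1), (x+i) =
        x * ((∏ i ∈ Finset.range M, (x+1+i)) * (x+1+M)) := by
      rw [Finset.prod_range_succ, p1]; push_cast; ring
    rw [p1, p2, p3, Nat.factorial_succ]
    have hp : 0 < ∏ i ∈ Finset.range M, (x+1+i) := by
      apply Finset.prod_pos; intro i _; positivity
    have : x + 1 + (M:ℝ) ≠ 0 := by positivity
    push_cast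
    field_simp
    ring

/-- weighted alternating sum -/
noncomputable def altB (J M : ℕ) (F : ℝ → ℝ) : ℝ :=
  ∑ k ∈ Finset.range (M+1), (((J+M).factorial : ℝ)/(J.factorial * M.factorial)) *
    ((-1:ℝ)^k * (M.choose k) * F ((J:ℝ)+k))

theorem altB_pole (J M : ℕ) (hJ : 1 ≤ J) (r : ℝ) (hr : 0 ≤ r) :
    altB J M (fun x => 1/(x+r)) =
      1/((J:ℝ)+r) * ∏ i ∈ Finset.range M, ((J:ℝ)+1+i)/((J:ℝ)+1+i+r) := by
  have hJ' : (0:ℝ) < J := by exact_mod_cast hJ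
  have h := aux_fd M ((J:ℝ)+r) (by positivity)
  unfold altB
  rw [← Finset.mul_sum]
  have e : ∀ k ∈ Finset.range (M+1), (-1:ℝ)^k * (M.choose k) * (1/((J:ℝ)+k+r)) =
      (-1:ℝ)^k * (M.choose k) * (1/((J:ℝ)+r+k)) := by
    intro k _; rw [add_right_comm]
  rw [Finset.sum_congr rfl e, h, Finset.prod_div_distrib]
  have f : ((J+M).factorial : ℝ) = J.factorial * ∏ i ∈ Finset.range M, ((J:ℝ)+1+i) := by
    clear h e
    induction M with
    | zero => simp
    | succ M ih =>
      rw [← add_assoc, Nat.factorial_succ, Finset.prod_range_succ]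
      push_cast
      rw [ih]; ring
  have p : ∏ i ∈ Finset.range (M+1), ((J:ℝ)+r+i) =
      ((J:ℝ)+r) * ∏ i ∈ Finset.range M, ((J:ℝ)+1+i+r) := by
    rw [Finset.prod_range_succ', mul_comm]
    simp only [Nat.cast_zero, add_zero]
    congr 1
    apply Finset.prod_congr rfl; intro i _; push_cast; ring
  rw [f, p]
  have hp : 0 < ∏ i ∈ Finset.range M, ((J:ℝ)+1+i+r) := by
    apply Finset.prod_pos; intro i _; positivity
  have : (J:ℝ)+r ≠ 0 := by positivity
  have : (J.factorial:ℝ) ≠ 0 := by positivity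
  have : (M.factorial:ℝ) ≠ 0 := by positivity
  field_simp

theorem altB_const (J M : ℕ) (hM : 1 ≤ M) (a : ℝ) : altB J M (fun _ => a) = 0 := by
  unfold altB
  rw [← Finset.mul_sum, ← Finset.sum_mul]
  have := Int.alternating_sum_range_choose_of_ne (n := M) (by omega)
  have h : ∑ k ∈ Finset.range (M+1), (-1:ℝ)^k * (M.choose k) = 0 := by exact_mod_cast this
  rw [h]; ring

theorem fin_bound (L J M : ℕ) (hJ : 1 ≤ J) (hM : 1 ≤ M) (ρ : ℝ) (h1 : 1 < ρ) (h2 : ρ < 2)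
    (hneg : ∑ k ∈ Finset.range (L+1), 1/(((k:ℝ)+1) * ((k:ℝ)+1-ρ)) ≤ 0) :
    |altB J M (fun x => 1 / (∑ k ∈ Finset.range (L+1), x / (((k:ℝ)+1) * (x + ((k:ℝ)+1)))))
      - (1 / ∑ k ∈ Finset.range (L+1), 1/((k:ℝ)+1)^2) / J| ≤
    1 / (∑ k ∈ Finset.range (L+1), (J:ℝ) / (((k:ℝ)+1) * ((J:ℝ) + ((k:ℝ)+1)))) *
      ∏ i ∈ Finset.range M, ((J:ℝ)+1+i)/((J:ℝ)+1+i+ρ) := by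
  obtain ⟨c, r, hcr, hpf⟩ := aux_pf L ρ h1 h2 hneg
  have hJ' : (0:ℝ) < J := by exact_mod_cast hJ
  rw [hpf J hJ']
  set c0 := (1 / ∑ k ∈ Finset.range (L+1), 1/((k:ℝ)+1)^2) with hc0
  have hc0' : 0 < c0 := by
    rw [hc0]; apply one_div_pos.2
    apply Finset.sum_pos _ (by simp)
    intro i _; positivity
  have hH : 0 < 1 / harm (L+1) := by
    apply one_div_pos.2; unfold harm
    apply Finset.sum_pos _ (by simp)
    intro i _; positivity
  have e1 : altB J M (fun x => 1 / (∑ k ∈ Finset.range (L+1), x / (((k:ℝ)+1) * (x + ((k:ℝ)+1))))) =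
      altB J M (fun _ => 1 / harm (L+1)) + c0 * altB J M (fun x => 1/(x+0)) +
        ∑ i ∈ Finset.range L, c i * altB J M (fun x => 1/(x + r i)) := by
    unfold altB
    simp only [Finset.mul_sum]
    rw [Finset.sum_comm, ← Finset.sum_add_distrib, ← Finset.sum_add_distrib]
    apply Finset.sum_congr rfl
    intro k _
    rw [hpf _ (by positivity)]
    simp only [mul_add, Finset.mul_sum]
    congr 1
    · ring
    · apply Finset.sum_congr rfl; intro i _; ring
  rw [e1, altB_const J M hM, altB_pole J M hJ 0 le_rfl]
  have e2 : ∏ i ∈ Finset.range M, ((J:ℝ)+1+i)/((J:ℝ)+1+i+0) = 1 := by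
    apply Finset.prod_eq_one
    intro i _
    rw [add_zero]
    exact div_self (by positivity)
  have e3 : ∑ i ∈ Finset.range L, c i * altB J M (fun x => 1/(x + r i)) =
      ∑ i ∈ Finset.range L, c i / ((J:ℝ) + r i) *
        ∏ l ∈ Finset.range M, ((J:ℝ)+1+l)/((J:ℝ)+1+l+r i) := by
    apply Finset.sum_congr rfl
    intro i hi
    have := (hcr i (Finset.mem_range.1 hi)).2
    rw [altB_pole J M hJ (r i) (by linarith)]
    ring
  rw [e2, e3]
  have e4 : 0 + c0 * (1/((J:ℝ)+0) * 1) + ∑ i ∈ Finset.range L, c i / ((J:ℝ) + r i) *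
        ∏ l ∈ Finset.range M, ((J:ℝ)+1+l)/((J:ℝ)+1+l+r i) - c0 / J =
      ∑ i ∈ Finset.range L, c i / ((J:ℝ) + r i) *
        ∏ l ∈ Finset.range M, ((J:ℝ)+1+l)/((J:ℝ)+1+l+r i) := by
    rw [add_zero]; ring
  have hpn : ∀ i ∈ Finset.range L, 0 ≤ c i / ((J:ℝ) + r i) := by
    intro i hi
    obtain ⟨a, b⟩ := hcr i (Finset.mem_range.1 hi)
    have : 0 < r i := by linarith
    positivity
  rw [e4, abs_of_nonneg]
  · calc _ ≤ ∑ i ∈ Finset.range L, c i / ((J:ℝ) + r i) *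
        ∏ l ∈ Finset.range M, ((J:ℝ)+1+l)/((J:ℝ)+1+l+ρ) := by
          apply Finset.sum_le_sum
          intro i hi
          obtain ⟨a, b⟩ := hcr i (Finset.mem_range.1 hi)
          have : 0 < r i := by linarith
          apply mul_le_mul_of_nonneg_left _ (hpn i hi)
          apply Finset.prod_le_prod
          · intro l _; positivity
          · intro l _; gcongr
      _ = (∑ i ∈ Finset.range L, c i / ((J:ℝ) + r i)) *
        ∏ l ∈ Finset.range M, ((J:ℝ)+1+l)/((J:ℝ)+1+l+ρ) := by rw [Finset.sum_mul]
      _ ≤ _ := by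
          apply mul_le_mul_of_nonneg_right
          · have : 0 < c0 / J := by positivity
            linarith
          · apply Finset.prod_nonneg; intro l _; positivity
  · apply Finset.sum_nonneg
    intro i hi
    obtain ⟨a, b⟩ := hcr i (Finset.mem_range.1 hi)
    have : 0 < r i := by linarith
    apply mul_nonneg (hpn i hi)
    apply Finset.prod_nonneg; intro l _; positivity

theorem lim_g (m : ℕ) : Tendsto (fun L : ℕ =>
    ∑ k ∈ Finset.range (L+1), (m:ℝ) / (((k:ℝ)+1) * ((m:ℝ) + ((k:ℝ)+1)))) atTop (nhds (harm m)) := by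
  have h : ∀ L : ℕ, ∑ k ∈ Finset.range (L+1), (m:ℝ) / (((k:ℝ)+1) * ((m:ℝ) + ((k:ℝ)+1))) =
      harm m - ∑ i ∈ Finset.range m, 1/((i:ℝ) + 1 + ((L+1:ℕ):ℝ)) := by
    intro L
    have a : ∀ k ∈ Finset.range (L+1), (m:ℝ) / (((k:ℝ)+1) * ((m:ℝ) + ((k:ℝ)+1))) =
        1/((k:ℝ)+1) - 1/(((m+k:ℕ):ℝ)+1) := by
      intro k _
      have : (m:ℝ) + ((k:ℝ)+1) ≠ 0 := by positivity
      have : (m:ℝ) + (k:ℝ)+1 ≠ 0 := by positivity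
      push_cast
      field_simp
      ring
    have b := Finset.sum_range_add (fun k : ℕ => 1/((k:ℝ)+1)) m (L+1)
    have c := Finset.sum_range_add (fun k : ℕ => 1/((k:ℝ)+1)) (L+1) m
    rw [add_comm (L+1) m] at c
    have d : ∑ i ∈ Finset.range m, 1/((i:ℝ) + 1 + ((L+1:ℕ):ℝ)) =
        ∑ i ∈ Finset.range m, 1/(((L+1+i:ℕ):ℝ)+1) := by
      apply Finset.sum_congr rfl; intro i _; push_cast; congr 1; ring
    rw [Finset.sum_congr rfl a, Finset.sum_sub_distrib, d]
    unfold harm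
    linarith
  simp only [h]
  have : Tendsto (fun L : ℕ => ∑ i ∈ Finset.range m, 1/((i:ℝ) + 1 + ((L+1:ℕ):ℝ))) atTop
      (nhds (∑ i ∈ Finset.range m, (0:ℝ))) := by
    apply tendsto_finsetSum
    intro i _
    have t : Tendsto (fun L : ℕ => (i:ℝ) + 1 + ((L+1:ℕ):ℝ)) atTop atTop :=
      tendsto_atTop_add_const_left _ _
        (tendsto_natCast_atTop_atTop.comp (tendsto_add_atTop_nat 1))
    simp only [one_div]
    exact t.inv_tendsto_atTop
  simpa using this.const_sub (harm m)

theorem lim_c0 : Tendsto (fun L : ℕ => 1 / ∑ k ∈ Finset.range (L+1), 1/((k:ℝ)+1)^2) atTop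
    (nhds (6 / Real.pi^2)) := by
  have h := hasSum_zeta_two.tendsto_sum_nat.comp (tendsto_add_atTop_nat 2)
  have e : (fun L : ℕ => ∑ k ∈ Finset.range (L+1), 1/((k:ℝ)+1)^2) =
      (fun n => ∑ i ∈ Finset.range n, 1/(i:ℝ)^2) ∘ (fun a => a + 2) := by
    funext L
    simp only [Function.comp]
    rw [Finset.sum_range_succ' _ (L+1)]
    simp
  rw [← e] at h
  have := h.inv₀ (by positivity)
  simpa [inv_div] using this

theorem A_eq (J M : ℕ) : A (J+1+M) (J+1) =
    harm J * ∑ k ∈ Finset.range (M+1), (((J+M).factorial : ℝ)/(J.factorial * M.factorial)) *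
    ((-1:ℝ)^k * (M.choose k) * (1 / harm (J+k))) := by
  unfold A
  have e1 : J+1+M-(J+1) = M := by omega
  have e2 : J+1+M-1 = J+M := by omega
  rw [e1, e2, Finset.mul_sum]
  apply Finset.sum_congr rfl
  intro k hk
  have hk' : k ≤ M := by simp at hk; omega
  have e3 : J+1+k-1 = J+k := by omega
  rw [e3, Nat.add_sub_cancel, Nat.cast_choose ℝ hk']
  have : (M.factorial:ℝ) ≠ 0 := by positivity
  field_simp

theorem main_bound (s₁ : ℝ) (hs₁ : s₁ ∈ Set.Ioo (-1:ℝ) 0) (hroot : digamma s₁ = digamma 1)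
    (J M : ℕ) (hJ : 1 ≤ J) (hM : 1 ≤ M) :
    |A (J+1+M) (J+1) - (6/Real.pi^2) * harm J / J| ≤ (((J:ℝ)+3)/((J:ℝ)+M+3))^(1-s₁) := by
  have hb : ∀ L, _ := fun L => fin_bound L J M hJ hM (1-s₁) (by linarith [hs₁.2])
    (by linarith [hs₁.1]) (aux_neg s₁ hs₁ hroot L)
  have hpos : ∀ m : ℕ, 1 ≤ m → 0 < harm m := by
    intro m hm
    unfold harm
    apply Finset.sum_pos _ (by simp; omega)
    intro i _; positivity
  have hg : ∀ m : ℕ, 1 ≤ m → Tendsto (fun L : ℕ =>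
    1 / ∑ k ∈ Finset.range (L+1), (m:ℝ) / (((k:ℝ)+1) * ((m:ℝ) + ((k:ℝ)+1)))) atTop
      (nhds (1/harm m)) := by
    intro m hm
    exact tendsto_const_nhds.div (lim_g m) (hpos m hm).ne'
  have hlim : Tendsto (fun L : ℕ => altB J M
      (fun x => 1 / (∑ k ∈ Finset.range (L+1), x / (((k:ℝ)+1) * (x + ((k:ℝ)+1)))))) atTop
      (nhds (∑ k ∈ Finset.range (M+1), (((J+M).factorial : ℝ)/(J.factorial * M.factorial)) *
    ((-1:ℝ)^k * (M.choose k) * (1 / harm (J+k))))) := by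
    unfold altB
    apply tendsto_finsetSum
    intro k _
    apply Tendsto.const_mul
    apply Tendsto.const_mul
    have := hg (J+k) (by omega)
    push_cast at this
    exact this
  have hfin := le_of_tendsto_of_tendsto' (hlim.sub (lim_c0.div_const (J:ℝ))).abs
    ((hg J hJ).mul_const _) hb
  have hh := hpos J hJ
  have e : A (J+1+M) (J+1) - (6/Real.pi^2) * harm J / J = harm J *
    (∑ k ∈ Finset.range (M+1), (((J+M).factorial : ℝ)/(J.factorial * M.factorial)) *
    ((-1:ℝ)^k * (M.choose k) * (1 / harm (J+k))) - 6/Real.pi^2/J) := by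
    rw [A_eq]; ring
  rw [e, abs_mul, abs_of_pos hh]
  refine le_trans (mul_le_mul_of_nonneg_left hfin hh.le) ?_
  rw [← mul_assoc, mul_one_div_cancel hh.ne', one_mul]
  exact aux_prod J M (1-s₁) (by linarith [hs₁.2]) (by linarith [hs₁.1])

/--
For integers `2 ≤ j ≤ n` define `A(n,j)` as above. Then for every fixed integer `j ≥ 2` there
is a constant `C_j` such that for all `n ≥ j`,
`|A(n,j) - (6/π²)·h_{j-1}/(j-1)| ≤ C_j · n^{-1-|s₁|}`, where `s₁ ∈ (-1,0)` is the unique root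
of `ψ(s) = ψ(1)` in `(-1,0)`. In particular `A(n,j) → (6/π²)·h_{j-1}/(j-1)` as `n → ∞`.
-/
theorem stmt14 (j : ℕ) (hj : 2 ≤ j)
    (s₁ : ℝ) (hs₁ : s₁ ∈ Set.Ioo (-1:ℝ) 0) (hroot : digamma s₁ = digamma 1) :
    (∃ C : ℝ, ∀ n : ℕ, j ≤ n →
      |A n j - (6 / Real.pi ^ 2) * harm (j - 1) / ((j : ℝ) - 1)|
        ≤ C * (n : ℝ) ^ (-1 - |s₁|)) ∧
    Tendsto (fun n : ℕ => A n j) atTop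
      (nhds ((6 / Real.pi ^ 2) * harm (j - 1) / ((j : ℝ) - 1))) := by
  obtain ⟨J, rfl⟩ : ∃ J, j = J + 1 := ⟨j-1, by omega⟩
  have hJ : 1 ≤ J := by omega
  have hs0 := hs₁.2
  have hs1 := hs₁.1
  have hexp : -1 - |s₁| = -(1 - s₁) := by rw [abs_of_neg hs0]; ring
  have hJc : ((J+1:ℕ):ℝ) - 1 = J := by push_cast; ring
  rw [hexp, hJc, Nat.add_sub_cancel]
  have hmain : ∃ C : ℝ, ∀ n : ℕ, J+1 ≤ n →
      |A n (J+1) - (6 / Real.pi ^ 2) * harm J / J| ≤ C * (n : ℝ) ^ (-(1-s₁)) := by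
    set D := |A (J+1) (J+1) - (6 / Real.pi ^ 2) * harm J / J| with hD
    have hD0 : 0 ≤ D := abs_nonneg _
    refine ⟨((J:ℝ)+3)^(1-s₁) + D * ((J+1:ℕ):ℝ)^(1-s₁), ?_⟩
    intro n hn
    obtain ⟨M, rfl⟩ := Nat.exists_eq_add_of_le hn
    have hnpos : (0:ℝ) < ((J+1+M:ℕ):ℝ) := by positivity
    rw [add_mul]
    rcases Nat.eq_zero_or_pos M with h | h
    · subst h
      rw [add_zero, ← hD, mul_assoc, ← Real.rpow_add (by positivity)]
      have : 0 ≤ ((J:ℝ)+3)^(1-s₁) * ((J+1:ℕ):ℝ)^(-(1-s₁)) := by positivity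
      simp
      simpa using this
    · have hb := main_bound s₁ hs₁ hroot J M hJ h
      have h2 : (((J:ℝ)+3)/((J:ℝ)+M+3))^(1-s₁) ≤ ((J:ℝ)+3)^(1-s₁) * ((J+1+M:ℕ):ℝ)^(-(1-s₁)) := by
        rw [Real.rpow_neg hnpos.le, ← div_eq_mul_inv, ← Real.div_rpow (by positivity) hnpos.le]
        apply Real.rpow_le_rpow (by positivity) _ (by linarith)
        apply div_le_div_of_nonneg_left (by positivity) hnpos
        push_cast; linarith
      have h3 : 0 ≤ D * ((J+1:ℕ):ℝ)^(1-s₁) * ((J+1+M:ℕ):ℝ)^(-(1-s₁)) := by positivity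
      linarith
  refine ⟨hmain, ?_⟩
  obtain ⟨C, hC⟩ := hmain
  rw [tendsto_iff_norm_sub_tendsto_zero]
  have ht : Tendsto (fun n : ℕ => C * (n:ℝ)^(-(1-s₁))) atTop (nhds 0) := by
    have := ((tendsto_rpow_neg_atTop (y := 1-s₁) (by linarith)).comp
      tendsto_natCast_atTop_atTop).const_mul C
    simpa using this
  apply squeeze_zero' (Eventually.of_forall fun n => norm_nonneg _) _ ht
  filter_upwards [eventually_ge_atTop (J+1)] with n hn
  exact hC n hn
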